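/- arXiv:2203.14598 — 3 statements merged into one kernel-verified Lean document; each statement's English description precedes it below -/
import Mathlib

section
/- Let Γ and Λ be countable groups with fixed generating systems S_Γ and S_Λ, and let Γ ↷^α (X,μ) and Λ ↷^β (Y,ν) be p.m.p. actions. Suppose there is a measure-preserving bimeasurable bijection Φ : (X,μ) → (Y,ν) and two length-preserving cocycles σ : Γ × X → Λ and τ : Λ × Y → Γ such that for all γ ∈ Γ and λ ∈ Λ one has Φ(α(γ)x) = β(σ(γ,x))Φ(x) for μ-almost every x ∈ X, and Φ(α(τ(λ,y))Φ⁻¹(y)) = β(λ)y for ν-almost every y ∈ Y. Then α and β are isometric orbit equivalent. -/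
open MeasureTheory

namespace IOE

/-- Word length of a group element with respect to a set `S`, valued in `ℕ∞`
(`⊤` if the element is not a product of elements of `S`). -/
noncomputable def wlen {G : Type*} [Group G] (S : Set G) (g : G) : ℕ∞ :=
  sInf {n : ℕ∞ | ∃ l : List G, (∀ s ∈ l, s ∈ S) ∧ l.prod = g ∧ (l.length : ℕ∞) = n}

/-- A generating system: a symmetric generating set not containing the identity. -/
structure IsGenSystem {G : Type*} [Group G] (S : Set G) : Prop where
  inv_mem : ∀ s ∈ S, s⁻¹ ∈ S
  one_not_mem : (1 : G) ∉ S
  closure_eq_top : Subgroup.closure S = ⊤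

/-- A finite generating system. -/
structure IsFinGenSystem {G : Type*} [Group G] (S : Set G) extends IsGenSystem S : Prop where
  finite : S.Finite

/-- The extended graph metric on `X` associated with an action `act` of `G` on `X`
and a set `S ⊆ G`: the length of a shortest `S`-path from `x` to `y`. -/
noncomputable def gdist {G X : Type*} (act : G → X → X) (S : Set G) (x y : X) : ℕ∞ :=
  sInf {n : ℕ∞ | ∃ l : List G, (∀ s ∈ l, s ∈ S) ∧ l.foldr act x = y ∧ (l.length : ℕ∞) = n}

/-- A set is saturated if it is a union of connected components of the graphing. -/
def Saturated {G X : Type*} (act : G → X → X) (S : Set G) (A : Set X) : Prop :=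
  ∀ x ∈ A, ∀ y : X, gdist act S x y ≠ ⊤ → y ∈ A

/-- `act` is a probability-measure-preserving action of `G` on `(X, μ)`. -/
structure IsPmpAction {G X : Type*} [Group G] [MeasurableSpace X]
    (act : G → X → X) (μ : Measure X) : Prop where
  one_act : ∀ x, act 1 x = x
  mul_act : ∀ g h x, act (g * h) x = act g (act h x)
  measurePreserving : ∀ g, MeasurePreserving (act g) μ μ

/-- An action is essentially free if almost every point has trivial stabilizer. -/
def EssentiallyFree {G X : Type*} [Group G] [MeasurableSpace X]
    (act : G → X → X) (μ : Measure X) : Prop :=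
  ∀ᵐ x ∂μ, ∀ g : G, act g x = x → g = 1

/-- Two actions are isometric orbit equivalent: there is a measure-preserving
bimeasurable bijection which is an isometry between the graphings, on a saturated
conull set. -/
def IsomOrbitEquiv {G H X Y : Type*} [MeasurableSpace X] [MeasurableSpace Y]
    (actA : G → X → X) (SG : Set G) (μ : Measure X)
    (actB : H → Y → Y) (SH : Set H) (ν : Measure Y) : Prop :=
  ∃ Φ : X ≃ Y, Measurable Φ ∧ Measurable Φ.symm ∧ MeasurePreserving Φ μ ν ∧
    ∃ X₀ : Set X, μ X₀ᶜ = 0 ∧ Saturated actA SG X₀ ∧ Saturated actB SH (Φ '' X₀) ∧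
      ∀ x ∈ X₀, ∀ x' ∈ X₀, gdist actB SH (Φ x) (Φ x') = gdist actA SG x x'

/-- A measurable cocycle `σ : G × X → H` for the action `act` of `G` on `(X, μ)`. -/
def IsCocycle {G H X : Type*} [Group G] [Group H] [MeasurableSpace X]
    (act : G → X → X) (μ : Measure X) (σ : G → X → H) : Prop :=
  (∀ (g : G) (h : H), MeasurableSet {x | σ g x = h}) ∧
  ∀ g h : G, ∀ᵐ x ∂μ, σ (g * h) x = σ g (act h x) * σ h x

/-- A cocycle is length-preserving if it preserves the word lengths almost surely. -/
def LengthPreservingCocycle {G H X : Type*} [Group G] [Group H] [MeasurableSpace X]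
    (SG : Set G) (SH : Set H) (μ : Measure X) (σ : G → X → H) : Prop :=
  ∀ g : G, ∀ᵐ x ∂μ, wlen SH (σ g x) = wlen SG g

end IOE

open MeasureTheory IOE

namespace IOE

section Graphing

variable {G X : Type*} [Group G] [MeasurableSpace X] {act : G → X → X} {μ : Measure X}

theorem IsPmpAction.foldr_eq (h : IsPmpAction act μ) (l : List G) (x : X) :
    l.foldr act x = act l.prod x := by
  induction l with
  | nil => simp [h.one_act]
  | cons a l ih => simp [ih, h.mul_act]

theorem wlen_prod_le {S : Set G} {l : List G} (hl : ∀ s ∈ l, s ∈ S) :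
    wlen S l.prod ≤ l.length :=
  sInf_le ⟨l, hl, rfl, rfl⟩

theorem IsPmpAction.gdist_le_wlen (h : IsPmpAction act μ) (S : Set G) (g : G) (x : X) :
    gdist act S x (act g x) ≤ wlen S g := by
  refine le_sInf ?_
  rintro n ⟨l, hl, rfl, rfl⟩
  exact sInf_le ⟨l, hl, h.foldr_eq l x, rfl⟩

theorem IsPmpAction.le_gdist (h : IsPmpAction act μ) {S : Set G} {x y : X} {n : ℕ∞}
    (hn : ∀ g, act g x = y → n ≤ wlen S g) : n ≤ gdist act S x y := by
  refine le_sInf ?_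
  rintro m ⟨l, hl, hxy, rfl⟩
  exact (hn l.prod ((h.foldr_eq l x).symm.trans hxy)).trans (wlen_prod_le hl)

theorem IsPmpAction.exists_of_gdist_ne_top (h : IsPmpAction act μ) {S : Set G} {x y : X}
    (hxy : gdist act S x y ≠ ⊤) : ∃ g, act g x = y := by
  by_contra! hne
  exact hxy (top_le_iff.1 (h.le_gdist fun g hg => absurd hg (hne g)))

end Graphing

end IOE

/-- If two p.m.p. actions of countable groups with fixed generating
systems are intertwined by a measure-preserving bimeasurable bijection together with a
pair of length-preserving cocycles, then they are isometric orbit equivalent. -/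
theorem stmt0
    {Γ Λ X Y : Type*} [Group Γ] [Countable Γ] [Group Λ] [Countable Λ]
    [MeasurableSpace X] [StandardBorelSpace X] [MeasurableSpace Y] [StandardBorelSpace Y]
    (SΓ : Set Γ) (SΛ : Set Λ) (hSΓ : IsGenSystem SΓ) (hSΛ : IsGenSystem SΛ)
    (μ : Measure X) (ν : Measure Y) [IsProbabilityMeasure μ] [IsProbabilityMeasure ν]
    (α : Γ → X → X) (β : Λ → Y → Y)
    (hα : IsPmpAction α μ) (hβ : IsPmpAction β ν)
    (Φ : X ≃ Y) (hΦ : Measurable Φ) (hΦ' : Measurable Φ.symm)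
    (hΦμ : MeasurePreserving Φ μ ν)
    (σ : Γ → X → Λ) (τ : Λ → Y → Γ)
    (hσ : IsCocycle α μ σ) (hτ : IsCocycle β ν τ)
    (hσlen : LengthPreservingCocycle SΓ SΛ μ σ)
    (hτlen : LengthPreservingCocycle SΛ SΓ ν τ)
    (hστ : ∀ γ : Γ, ∀ᵐ x ∂μ, Φ (α γ x) = β (σ γ x) (Φ x))
    (hτσ : ∀ lam : Λ, ∀ᵐ y ∂ν, Φ (α (τ lam y) (Φ.symm y)) = β lam y) :
    IsomOrbitEquiv α SΓ μ β SΛ ν := by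
  have hA : ∀ᵐ x ∂μ, ∀ γ, Φ (α γ x) = β (σ γ x) (Φ x) ∧ wlen SΛ (σ γ x) = wlen SΓ γ :=
    ae_all_iff.2 fun γ => (hστ γ).and (hσlen γ)
  have hB : ∀ᵐ y ∂ν, ∀ lam, Φ (α (τ lam y) (Φ.symm y)) = β lam y ∧
      wlen SΓ (τ lam y) = wlen SΛ lam :=
    ae_all_iff.2 fun lam => (hτσ lam).and (hτlen lam)
  have hC := hA.and (hΦμ.quasiMeasurePreserving.ae hB)
  have hX₀ := ae_all_iff.2 fun γ => (hα.measurePreserving γ).quasiMeasurePreserving.ae hC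
  refine ⟨Φ, hΦ, hΦ', hΦμ, _, hX₀, ?_, ?_, ?_⟩
  · intro x hx y hxy
    obtain ⟨g, rfl⟩ := hα.exists_of_gdist_ne_top hxy
    intro γ
    rw [← hα.mul_act]
    exact hx (γ * g)
  · rintro _ ⟨x, hx, rfl⟩ y hxy
    obtain ⟨lam, rfl⟩ := hβ.exists_of_gdist_ne_top hxy
    have h1 := hx 1
    rw [hα.one_act] at h1
    have h2 := (h1.2 lam).1
    rw [Φ.symm_apply_apply] at h2
    refine ⟨_, fun γ => ?_, h2⟩
    rw [← hα.mul_act]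
    exact hx (γ * τ lam (Φ x))
  · intro x hx x' _
    have h1 := hx 1
    rw [hα.one_act] at h1
    apply le_antisymm
    · refine hα.le_gdist ?_
      rintro γ rfl
      rw [(h1.1 γ).1, ← (h1.1 γ).2]
      exact hβ.gdist_le_wlen SΛ _ _
    · refine hβ.le_gdist fun lam hlam => ?_
      have h2 := (h1.2 lam).1
      rw [Φ.symm_apply_apply, hlam] at h2
      rw [← Φ.injective h2, ← (h1.2 lam).2]
      exact hα.gdist_le_wlen SΓ _ _
end

section
/- Let Γ = ⟨S_Γ⟩ and Λ = ⟨S_Λ⟩ be countable groups with fixed generating systems. Two p.m.p. essentially free actions Γ ↷^α (X,μ) and Λ ↷^β (Y,ν) are isometric orbit equivalent if and only if there exists a length-preserving orbit equivalence between them, i.e. an orbit equivalence Φ whose associated orbit equivalence cocycles σ : Γ × X → Λ and τ : Λ × Y → Γ are both length-preserving. -/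
open MeasureTheory

open MeasureTheory IOE

namespace IOE
/-- `Φ` is an orbit equivalence between the actions `actA` on `(X,μ)` and `actB` on `(Y,ν)`. -/
def IsOrbitEquiv {G H X Y : Type*} [MeasurableSpace X] [MeasurableSpace Y]
    (actA : G → X → X) (μ : Measure X) (actB : H → Y → Y) (ν : Measure Y)
    (Φ : X ≃ Y) : Prop :=
  Measurable Φ ∧ Measurable Φ.symm ∧ MeasurePreserving Φ μ ν ∧
    ∀ᵐ x ∂μ, Φ '' (Set.range fun g => actA g x) = Set.range fun h => actB h (Φ x)
end IOE

namespace IOE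

section Graphing

variable {G X : Type*} [Group G] {act : G → X → X} {S : Set G}

theorem foldr_act_eq_prod_act (one_act : ∀ x, act 1 x = x)
    (mul_act : ∀ g h x, act (g * h) x = act g (act h x)) (l : List G) (x : X) :
    l.foldr act x = act l.prod x := by
  induction l with
  | nil => simp [one_act]
  | cons a l ih => simp [ih, mul_act]

theorem gdist_ne_top_iff (one_act : ∀ x, act 1 x = x)
    (mul_act : ∀ g h x, act (g * h) x = act g (act h x)) (hS : IsGenSystem S) (x y : X) :
    gdist act S x y ≠ ⊤ ↔ ∃ g, act g x = y := by
  constructor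
  · intro h
    by_contra hne
    refine h (sInf_eq_top.2 ?_)
    rintro n ⟨l, -, hl, -⟩
    exact absurd ⟨l.prod, by rw [← foldr_act_eq_prod_act one_act mul_act, hl]⟩ hne
  · rintro ⟨g, rfl⟩
    have hg : g ∈ (Subgroup.closure S).toSubmonoid := by simp [hS.closure_eq_top]
    rw [Subgroup.closure_toSubmonoid] at hg
    obtain ⟨l, hl, rfl⟩ := Submonoid.exists_list_of_mem_closure hg
    refine ne_top_of_le_ne_top (ENat.natCast_ne_top l.length) (sInf_le ⟨l, fun s hs => ?_, ?_, rfl⟩)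
    · rcases hl s hs with h | h
      · exact h
      · simpa using hS.inv_mem _ h
    · exact foldr_act_eq_prod_act one_act mul_act l x

theorem gdist_act_of_free (one_act : ∀ x, act 1 x = x)
    (mul_act : ∀ g h x, act (g * h) x = act g (act h x)) {x : X}
    (hx : ∀ g : G, act g x = x → g = 1) (g : G) :
    gdist act S x (act g x) = wlen S g := by
  have key (l : List G) : l.foldr act x = act g x ↔ l.prod = g := by
    rw [foldr_act_eq_prod_act one_act mul_act]
    refine ⟨fun h => ?_, fun h => by rw [h]⟩
    have h1 := hx (g⁻¹ * l.prod) (by rw [mul_act, h, ← mul_act, inv_mul_cancel, one_act])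
    exact (inv_mul_eq_one.1 h1).symm
  simp only [gdist, wlen, key]

end Graphing

section IsometricBijection

variable {G H X Y : Type*} [Group G] [Group H] [MeasurableSpace X] [MeasurableSpace Y]
  {actA : G → X → X} {SG : Set G} {μ : Measure X}
  {actB : H → Y → Y} {SH : Set H} {ν : Measure Y}

/-- A measure-preserving bijection which is an isometry between the graphings on a saturated
conull set has a length-preserving cocycle. -/
theorem exists_lengthPreservingCocycle (hA : IsPmpAction actA μ) (hB : IsPmpAction actB ν)
    (hSG : IsGenSystem SG) (hSH : IsGenSystem SH)
    (hAfree : EssentiallyFree actA μ) (hBfree : EssentiallyFree actB ν)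
    {Φ : X → Y} (hΦ : MeasurePreserving Φ μ ν) {X₀ : Set X} (hX₀ : ∀ᵐ x ∂μ, x ∈ X₀)
    (hsat : Saturated actA SG X₀)
    (hdist : ∀ x ∈ X₀, ∀ x' ∈ X₀, gdist actB SH (Φ x) (Φ x') = gdist actA SG x x') :
    ∃ σ : G → X → H, (∀ g, ∀ᵐ x ∂μ, Φ (actA g x) = actB (σ g x) (Φ x)) ∧
      LengthPreservingCocycle SG SH μ σ := by
  have hmem : ∀ x ∈ X₀, ∀ g, actA g x ∈ X₀ := fun x hx g =>
    hsat x hx _ ((gdist_ne_top_iff hA.one_act hA.mul_act hSG _ _).2 ⟨g, rfl⟩)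
  have hex (g : G) (x : X) : ∃ h, x ∈ X₀ → actB h (Φ x) = Φ (actA g x) := by
    by_cases hx : x ∈ X₀
    · have hne : gdist actB SH (Φ x) (Φ (actA g x)) ≠ ⊤ := by
        rw [hdist x hx _ (hmem x hx g)]
        exact (gdist_ne_top_iff hA.one_act hA.mul_act hSG _ _).2 ⟨g, rfl⟩
      obtain ⟨h, hh⟩ := (gdist_ne_top_iff hB.one_act hB.mul_act hSH _ _).1 hne
      exact ⟨h, fun _ => hh⟩
    · exact ⟨1, fun h => absurd h hx⟩
  choose σ hσ using hex
  refine ⟨σ, fun g => hX₀.mono fun x hx => (hσ g x hx).symm, fun g => ?_⟩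
  filter_upwards [hX₀, hAfree, hΦ.quasiMeasurePreserving.ae hBfree] with x hx hxA hxB
  rw [← gdist_act_of_free hB.one_act hB.mul_act hxB, hσ g x hx, hdist x hx _ (hmem x hx g),
    gdist_act_of_free hA.one_act hA.mul_act hxA]

theorem image_orbit_eq_of_isometry (hA : IsPmpAction actA μ) (hB : IsPmpAction actB ν)
    (hSG : IsGenSystem SG) (hSH : IsGenSystem SH) {Φ : X → Y} {X₀ : Set X}
    (hsatA : Saturated actA SG X₀) (hsatB : Saturated actB SH (Φ '' X₀))
    (hdist : ∀ x ∈ X₀, ∀ x' ∈ X₀, gdist actB SH (Φ x) (Φ x') = gdist actA SG x x')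
    {x : X} (hx : x ∈ X₀) :
    Φ '' (Set.range fun g => actA g x) = Set.range fun h => actB h (Φ x) := by
  ext y
  constructor
  · rintro ⟨_, ⟨g, rfl⟩, rfl⟩
    have hne := (gdist_ne_top_iff hA.one_act hA.mul_act hSG x (actA g x)).2 ⟨g, rfl⟩
    rw [← hdist x hx _ (hsatA x hx _ hne)] at hne
    exact (gdist_ne_top_iff hB.one_act hB.mul_act hSH _ _).1 hne
  · rintro ⟨h, rfl⟩
    have hne := (gdist_ne_top_iff hB.one_act hB.mul_act hSH (Φ x) (actB h (Φ x))).2 ⟨h, rfl⟩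
    obtain ⟨x', hx', hxx'⟩ := hsatB _ ⟨x, hx, rfl⟩ _ hne
    rw [← hxx', hdist x hx x' hx'] at hne
    exact ⟨x', (gdist_ne_top_iff hA.one_act hA.mul_act hSG _ _).1 hne, hxx'⟩

/-- An orbit equivalence with a length-preserving cocycle is an isometry between the graphings
on a saturated conull set. -/
theorem isomOrbitEquiv_of_lengthPreservingCocycle [Countable G] (hA : IsPmpAction actA μ)
    (hB : IsPmpAction actB ν) (hSG : IsGenSystem SG) (hSH : IsGenSystem SH)
    (hAfree : EssentiallyFree actA μ) (hBfree : EssentiallyFree actB ν)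
    {Φ : X ≃ Y} (hΦ : IsOrbitEquiv actA μ actB ν Φ) {σ : G → X → H}
    (hσ : ∀ g, ∀ᵐ x ∂μ, Φ (actA g x) = actB (σ g x) (Φ x))
    (hlen : LengthPreservingCocycle SG SH μ σ) :
    IsomOrbitEquiv actA SG μ actB SH ν := by
  obtain ⟨hmeas, hmeas', hmp, horb⟩ := hΦ
  let good : X → Prop := fun x =>
    Φ '' (Set.range fun g => actA g x) = (Set.range fun h => actB h (Φ x)) ∧
      (∀ g, Φ (actA g x) = actB (σ g x) (Φ x)) ∧
      (∀ g, wlen SH (σ g x) = wlen SG g) ∧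
      (∀ g, actA g x = x → g = 1) ∧
      (∀ h, actB h (Φ x) = Φ x → h = 1)
  have hgood : ∀ᵐ x ∂μ, good x := by
    filter_upwards [horb, ae_all_iff.2 hσ, ae_all_iff.2 hlen, hAfree,
      hmp.quasiMeasurePreserving.ae hBfree] with x h1 h2 h3 h4 h5
    exact ⟨h1, h2, h3, h4, h5⟩
  let X₀ : Set X := {x | ∀ k : G, good (actA k x)}
  have hX₀ : ∀ᵐ x ∂μ, x ∈ X₀ :=
    ae_all_iff.2 fun k => (hA.measurePreserving k).quasiMeasurePreserving.ae hgood
  have hmem : ∀ x ∈ X₀, ∀ g, actA g x ∈ X₀ := fun x hx g k => by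
    rw [← hA.mul_act]
    exact hx (k * g)
  have hone (x : X) (hx : x ∈ X₀) : good x := hA.one_act x ▸ hx 1
  refine ⟨Φ, hmeas, hmeas', hmp, X₀, hX₀, ?_, ?_, ?_⟩
  · intro x hx y hy
    obtain ⟨g, rfl⟩ := (gdist_ne_top_iff hA.one_act hA.mul_act hSG _ _).1 hy
    exact hmem x hx g
  · rintro _ ⟨x, hx, rfl⟩ y hy
    have hy' : y ∈ Set.range fun h => actB h (Φ x) :=
      (gdist_ne_top_iff hB.one_act hB.mul_act hSH _ _).1 hy
    rw [← (hone x hx).1] at hy'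
    obtain ⟨_, ⟨g, rfl⟩, rfl⟩ := hy'
    exact ⟨_, hmem x hx g, rfl⟩
  · intro x hx x' _
    obtain ⟨h1, h2, h3, h4, h5⟩ := hone x hx
    by_cases hxx' : ∃ g, actA g x = x'
    · obtain ⟨g, rfl⟩ := hxx'
      rw [h2, gdist_act_of_free hB.one_act hB.mul_act h5, h3,
        gdist_act_of_free hA.one_act hA.mul_act h4]
    · have hyy' : ¬ ∃ h, actB h (Φ x) = Φ x' := by
        intro hh
        have hmem' : Φ x' ∈ Set.range fun h => actB h (Φ x) := hh
        rw [← h1, Φ.injective.mem_set_image] at hmem'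
        exact hxx' hmem'
      rw [← gdist_ne_top_iff hA.one_act hA.mul_act hSG, not_not] at hxx'
      rw [← gdist_ne_top_iff hB.one_act hB.mul_act hSH, not_not] at hyy'
      rw [hxx', hyy']

end IsometricBijection

end IOE

/-- Two p.m.p. essentially free actions are isometric orbit equivalent
iff there is a length-preserving orbit equivalence between them, i.e. an orbit
equivalence whose associated orbit equivalence cocycles are both length-preserving. -/
theorem stmt2
    {Γ Λ X Y : Type*} [Group Γ] [Countable Γ] [Group Λ] [Countable Λ]
    [MeasurableSpace X] [StandardBorelSpace X] [MeasurableSpace Y] [StandardBorelSpace Y]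
    (SΓ : Set Γ) (SΛ : Set Λ) (hSΓ : IsGenSystem SΓ) (hSΛ : IsGenSystem SΛ)
    (μ : Measure X) (ν : Measure Y) [IsProbabilityMeasure μ] [IsProbabilityMeasure ν]
    (α : Γ → X → X) (β : Λ → Y → Y)
    (hα : IsPmpAction α μ) (hβ : IsPmpAction β ν)
    (hαfree : EssentiallyFree α μ) (hβfree : EssentiallyFree β ν) :
    IsomOrbitEquiv α SΓ μ β SΛ ν ↔
      ∃ Φ : X ≃ Y, IsOrbitEquiv α μ β ν Φ ∧
        ∃ (σ : Γ → X → Λ) (τ : Λ → Y → Γ),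
          (∀ γ : Γ, ∀ᵐ x ∂μ, Φ (α γ x) = β (σ γ x) (Φ x)) ∧
          (∀ lam : Λ, ∀ᵐ y ∂ν, Φ (α (τ lam y) (Φ.symm y)) = β lam y) ∧
          LengthPreservingCocycle SΓ SΛ μ σ ∧
          LengthPreservingCocycle SΛ SΓ ν τ := by
  constructor
  · rintro ⟨Φ, hmeas, hmeas', hmp, X₀, hX₀, hsatA, hsatB, hdist⟩
    have hX₀' : ∀ᵐ x ∂μ, x ∈ X₀ := hX₀
    have hmp' : MeasurePreserving Φ.symm ν μ :=
      MeasurePreserving.symm ⟨Φ, hmeas, hmeas'⟩ hmp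
    have hY₀ : ∀ᵐ y ∂ν, y ∈ Φ '' X₀ :=
      (hmp'.quasiMeasurePreserving.ae hX₀').mono fun y hy => ⟨_, hy, Φ.apply_symm_apply y⟩
    have hdist' : ∀ y ∈ Φ '' X₀, ∀ y' ∈ Φ '' X₀,
        gdist α SΓ (Φ.symm y) (Φ.symm y') = gdist β SΛ y y' := by
      rintro _ ⟨x, hx, rfl⟩ _ ⟨x', hx', rfl⟩
      simp [hdist x hx x' hx']
    obtain ⟨σ, hσ, hσlen⟩ :=
      exists_lengthPreservingCocycle hα hβ hSΓ hSΛ hαfree hβfree hmp hX₀' hsatA hdist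
    obtain ⟨τ, hτ, hτlen⟩ :=
      exists_lengthPreservingCocycle hβ hα hSΛ hSΓ hβfree hαfree hmp' hY₀ hsatB hdist'
    refine ⟨Φ, ⟨hmeas, hmeas', hmp, hX₀'.mono fun x hx =>
      image_orbit_eq_of_isometry hα hβ hSΓ hSΛ hsatA hsatB hdist hx⟩, σ, τ, hσ,
      fun lam => (hτ lam).mono fun y hy => ?_, hσlen, hτlen⟩
    rw [← hy, Φ.apply_symm_apply]
  · rintro ⟨Φ, hΦ, σ, -, hσ, -, hσlen, -⟩
    exact isomOrbitEquiv_of_lengthPreservingCocycle hα hβ hSΓ hSΛ hαfree hβfree hΦ hσ hσlen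
end

section
/- Let Γ = ⟨S_Γ⟩ and Λ = ⟨S_Λ⟩ be finitely generated groups whose Cayley graphs (Γ,S_Γ) and (Λ,S_Λ) are isometric. Let μ and ν be the Haar probability measures on Iso₁(Γ,Λ) and Iso₁(Λ,Γ) respectively. Then: (i) the map σ : Γ × Iso₁(Γ,Λ) → Λ, σ(γ,f) := f(γ⁻¹)⁻¹, is a length-preserving cocycle for the natural Γ-action on Iso₁(Γ,Λ); (ii) the map τ : Λ × Iso₁(Λ,Γ) → Γ, τ(λ,f) := f(λ⁻¹)⁻¹, is a length-preserving cocycle for the natural Λ-action on Iso₁(Λ,Γ); (iii) the inverse map Φ : Iso₁(Γ,Λ) → Iso₁(Λ,Γ), f ↦ f⁻¹, is a measure-preserving bimeasurable bijection sending μ to ν satisfying Φ(γ·f) = σ(γ,f)·Φ(f) for all f ∈ Iso₁(Γ,Λ) and Φ(τ(λ,f)·Φ⁻¹(f)) = λ·f for all f ∈ Iso₁(Λ,Γ). -/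
open MeasureTheory

namespace IOE

variable {Γ Λ Ξ : Type*} [Group Γ] [Group Λ] [Group Ξ]

/-- A bijective isometry between the Cayley graphs `(Γ, S)` and `(Λ, T)`. -/
structure CayleyIso (S : Set Γ) (T : Set Λ) where
  toEquiv : Γ ≃ Λ
  isom : ∀ a b : Γ, wlen T ((toEquiv a)⁻¹ * toEquiv b) = wlen S (a⁻¹ * b)

namespace CayleyIso

variable {S : Set Γ} {T : Set Λ} {U : Set Ξ}

@[ext] theorem ext {f g : CayleyIso S T} (h : ∀ x, f.toEquiv x = g.toEquiv x) : f = g := by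
  cases f; cases g
  simp only [mk.injEq]
  exact Equiv.ext h

/-- Composition of Cayley isometries (`comp g f` applies `f` first). -/
def comp (g : CayleyIso T U) (f : CayleyIso S T) : CayleyIso S U where
  toEquiv := f.toEquiv.trans g.toEquiv
  isom := fun a b => by
    simpa [Equiv.trans_apply] using (g.isom (f.toEquiv a) (f.toEquiv b)).trans (f.isom a b)

/-- The inverse of a Cayley isometry. -/
def inv (f : CayleyIso S T) : CayleyIso T S where
  toEquiv := f.toEquiv.symm
  isom := fun a b => by
    simpa using (f.isom (f.toEquiv.symm a) (f.toEquiv.symm b)).symm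

/-- The identity Cayley isometry. -/
def refl (S : Set Γ) : CayleyIso S S := ⟨Equiv.refl Γ, fun _ _ => rfl⟩

/-- The group `Iso(Γ)` of bijective isometries of the Cayley graph `(Γ, S)`,
under composition. -/
instance : Group (CayleyIso S S) where
  mul f g := comp f g
  one := refl S
  inv := inv
  mul_assoc f g h := ext fun x => rfl
  one_mul f := ext fun x => rfl
  mul_one f := ext fun x => rfl
  inv_mul_cancel f := ext fun x => f.toEquiv.symm_apply_apply x

@[simp] theorem mul_apply (f g : CayleyIso S S) (x : Γ) :
    (f * g).toEquiv x = f.toEquiv (g.toEquiv x) := rfl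

@[simp] theorem one_apply (x : Γ) : (1 : CayleyIso S S).toEquiv x = x := rfl

@[simp] theorem inv_apply (f : CayleyIso S S) (x : Γ) :
    (f⁻¹).toEquiv x = f.toEquiv.symm x := rfl

/-- Left multiplication by a group element, as a Cayley isometry. -/
def leftMult (S : Set Γ) (γ : Γ) : CayleyIso S S where
  toEquiv := Equiv.mulLeft γ
  isom := fun a b => by
    simp only [Equiv.coe_mulLeft]
    congr 1
    group

@[simp] theorem leftMult_apply (γ x : Γ) : (leftMult S γ).toEquiv x = γ * x := rfl

/-- Post-composition by left multiplication. -/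
def lsmul (lam : Λ) (f : CayleyIso S T) : CayleyIso S T where
  toEquiv := f.toEquiv.trans (Equiv.mulLeft lam)
  isom := fun a b => by
    simp only [Equiv.trans_apply, Equiv.coe_mulLeft]
    rw [show (lam * f.toEquiv a)⁻¹ * (lam * f.toEquiv b)
        = (f.toEquiv a)⁻¹ * f.toEquiv b by group, f.isom]

@[simp] theorem lsmul_apply (lam : Λ) (f : CayleyIso S T) (x : Γ) :
    (lsmul lam f).toEquiv x = lam * f.toEquiv x := rfl

/-- The action of `Λ` on `Iso(Γ,Λ)` by post-composition. -/
instance : MulAction Λ (CayleyIso S T) where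
  smul := lsmul
  one_smul f := ext fun x => one_mul _
  mul_smul a b f := ext fun x => mul_assoc a b _

@[simp] theorem smul_apply (lam : Λ) (f : CayleyIso S T) (x : Γ) :
    (lam • f).toEquiv x = lam * f.toEquiv x := rfl

/-- The σ-algebra of pointwise convergence on `Iso(Γ,Λ)`. -/
instance : MeasurableSpace (CayleyIso S T) :=
  MeasurableSpace.comap (fun f (γ : Γ) => f.toEquiv γ)
    (@MeasurableSpace.pi Γ (fun _ => Λ) (fun _ => ⊤))

/-- The topology of pointwise convergence on `Iso(Γ,Λ)`. -/
instance : TopologicalSpace (CayleyIso S T) :=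
  TopologicalSpace.induced (fun f (γ : Γ) => f.toEquiv γ)
    (@Pi.topologicalSpace Γ (fun _ => Λ) (fun _ => ⊥))

end CayleyIso

/-- `Iso₁(Γ,Λ)`: the bijective isometries between the Cayley graphs sending `1` to `1`. -/
def Iso1 {Γ Λ : Type*} [Group Γ] [Group Λ] (S : Set Γ) (T : Set Λ) : Type _ :=
  {f : CayleyIso S T // f.toEquiv 1 = 1}

namespace Iso1

variable {S : Set Γ} {T : Set Λ}

instance : MeasurableSpace (Iso1 S T) := by unfold Iso1; infer_instance
instance : TopologicalSpace (Iso1 S T) := by unfold Iso1; infer_instance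

/-- The natural action of `Γ` on `Iso₁(Γ,Λ)`: `(γ · f)(δ) = f(γ⁻¹)⁻¹ f(γ⁻¹δ)`. -/
def natAct (γ : Γ) (f : Iso1 S T) : Iso1 S T :=
  ⟨CayleyIso.lsmul (f.1.toEquiv γ⁻¹)⁻¹ (CayleyIso.comp f.1 (CayleyIso.leftMult S γ⁻¹)), by
    show (f.1.toEquiv γ⁻¹)⁻¹ * f.1.toEquiv (γ⁻¹ * 1) = 1
    rw [mul_one, inv_mul_cancel]⟩

@[simp] theorem natAct_apply (γ : Γ) (f : Iso1 S T) (δ : Γ) :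
    (natAct γ f).1.toEquiv δ = (f.1.toEquiv γ⁻¹)⁻¹ * f.1.toEquiv (γ⁻¹ * δ) := rfl

/-- Pre-composition by an element of `Iso₁(Γ)`. -/
def pre1 (h : Iso1 S S) (f : Iso1 S T) : Iso1 S T :=
  ⟨CayleyIso.comp f.1 h.1, by show f.1.toEquiv (h.1.toEquiv 1) = 1; rw [h.2, f.2]⟩

/-- Post-composition by an element of `Iso₁(Λ)`. -/
def post1 (k : Iso1 T T) (f : Iso1 S T) : Iso1 S T :=
  ⟨CayleyIso.comp k.1 f.1, by show k.1.toEquiv (f.1.toEquiv 1) = 1; rw [f.2, k.2]⟩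

/-- The inverse map `Iso₁(Γ,Λ) → Iso₁(Λ,Γ)`. -/
def inv1 (f : Iso1 S T) : Iso1 T S :=
  ⟨f.1.inv, by
    show f.1.toEquiv.symm 1 = 1
    exact (Equiv.symm_apply_eq _).mpr f.2.symm⟩

/-- The inverse map, as a bijection `Iso₁(Γ,Λ) ≃ Iso₁(Λ,Γ)`. -/
def invEquiv1 : Iso1 S T ≃ Iso1 T S where
  toFun := inv1
  invFun := inv1
  left_inv f := Subtype.ext (CayleyIso.ext fun x => by simp [inv1, CayleyIso.inv])
  right_inv f := Subtype.ext (CayleyIso.ext fun x => by simp [inv1, CayleyIso.inv])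

end Iso1

end IOE

namespace IOE

section Wlen

variable {G : Type*} [Group G] {S : Set G}

theorem exists_list_length_eq_wlen {g : G} (hg : wlen S g ≠ ⊤) :
    ∃ l : List G, (∀ s ∈ l, s ∈ S) ∧ l.prod = g ∧ (l.length : ℕ∞) = wlen S g := by
  refine csInf_mem (s := {n : ℕ∞ | ∃ l : List G,
    (∀ s ∈ l, s ∈ S) ∧ l.prod = g ∧ (l.length : ℕ∞) = n}) ?_
  by_contra h
  refine hg ?_
  rw [wlen, Set.not_nonempty_iff_eq_empty.mp h, sInf_empty]

namespace IsGenSystem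

theorem exists_list_prod_eq (hS : IsGenSystem S) (g : G) :
    ∃ l : List G, (∀ s ∈ l, s ∈ S) ∧ l.prod = g := by
  have hg : g ∈ (Subgroup.closure S).toSubmonoid := hS.closure_eq_top ▸ Subgroup.mem_top g
  rw [Subgroup.closure_toSubmonoid] at hg
  obtain ⟨l, hl, hprod⟩ := Submonoid.exists_list_of_mem_closure hg
  refine ⟨l, fun s hs => (hl s hs).elim id fun h => ?_, hprod⟩
  simpa using hS.inv_mem _ h

theorem wlen_ne_top (hS : IsGenSystem S) (g : G) : wlen S g ≠ ⊤ := by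
  obtain ⟨l, hl, hprod⟩ := hS.exists_list_prod_eq g
  exact ne_top_of_le_ne_top (ENat.natCast_ne_top l.length) (sInf_le ⟨l, hl, hprod, rfl⟩)

end IsGenSystem

namespace IsFinGenSystem

theorem countable (hS : IsFinGenSystem S) : Countable G := by
  have : Countable S := hS.finite.countable
  refine Function.Surjective.countable (f := fun l : List S => (l.map Subtype.val).prod) fun g => ?_
  obtain ⟨l, hl, hprod⟩ := hS.exists_list_prod_eq g
  lift l to List S using hl
  exact ⟨l, hprod⟩

/-- Spheres in the Cayley graph of a finite generating system are finite. -/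
theorem finite_setOf_wlen_eq (hS : IsFinGenSystem S) (n : ℕ∞) : {g : G | wlen S g = n}.Finite := by
  have : Finite S := hS.finite
  rcases eq_or_ne n ⊤ with rfl | hn
  · simp [hS.wlen_ne_top]
  lift n to ℕ using hn
  refine ((List.finite_length_eq S n).image fun l => (l.map Subtype.val).prod).subset ?_
  intro g hg
  obtain ⟨l, hl, hprod, hlen⟩ := exists_list_length_eq_wlen (hS.wlen_ne_top g)
  lift l to List S using hl
  refine ⟨l, ?_, hprod⟩
  rw [show wlen S g = n from hg] at hlen
  simpa using hlen

end IsFinGenSystem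

end Wlen

namespace Iso1

variable {Γ Λ : Type*} [Group Γ] [Group Λ] {S : Set Γ} {T : Set Λ}

@[ext] theorem ext {f g : Iso1 S T} (h : ∀ x, f.1.toEquiv x = g.1.toEquiv x) : f = g :=
  Subtype.ext (CayleyIso.ext h)

@[simp] theorem apply_one (f : Iso1 S T) : f.1.toEquiv 1 = 1 := f.2

@[simp] theorem invEquiv1_apply (f : Iso1 S T) (x : Λ) :
    (invEquiv1 f).1.toEquiv x = f.1.toEquiv.symm x := rfl

@[simp] theorem invEquiv1_symm_apply (f : Iso1 T S) (x : Γ) :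
    ((invEquiv1 : Iso1 S T ≃ Iso1 T S).symm f).1.toEquiv x = f.1.toEquiv.symm x := rfl

@[simp] theorem post1_apply (k : Iso1 T T) (f : Iso1 S T) (x : Γ) :
    (post1 k f).1.toEquiv x = k.1.toEquiv (f.1.toEquiv x) := rfl

theorem wlen_apply (f : Iso1 S T) (x : Γ) : wlen T (f.1.toEquiv x) = wlen S x := by
  simpa using f.1.isom 1 x

theorem wlen_inv_apply_inv (f : Iso1 S T) (x : Γ) :
    wlen T (f.1.toEquiv x⁻¹)⁻¹ = wlen S x := by
  simpa using f.1.isom x⁻¹ 1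

/-- Post-composition acts transitively on `Iso₁(Γ,Λ)`. -/
theorem exists_post1_eq (f g : Iso1 S T) : ∃ k : Iso1 T T, post1 k f = g :=
  ⟨⟨g.1.comp f.1.inv, by
      simp [CayleyIso.comp, CayleyIso.inv, (Equiv.symm_apply_eq _).mpr f.2.symm]⟩,
    ext fun x => congrArg g.1.toEquiv (f.1.toEquiv.symm_apply_apply x)⟩

theorem invEquiv1_pre1_inv (k : Iso1 S S) (f : Iso1 S T) :
    invEquiv1 (pre1 (invEquiv1 k) f) = post1 k (invEquiv1 f) := rfl

theorem invEquiv1_natAct (γ : Γ) (f : Iso1 S T) :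
    invEquiv1 (natAct γ f) = natAct ((f.1.toEquiv γ⁻¹)⁻¹) (invEquiv1 f) := by
  ext x
  rw [invEquiv1_apply, Equiv.symm_apply_eq]
  simp

/-- The inclusion of `Iso₁(Γ,Λ)` into the space of all maps `Γ → Λ`. -/
def toFun (f : Iso1 S T) : Γ → Λ := f.1.toEquiv

theorem measurableSpace_eq_comap : (instMeasurableSpace : MeasurableSpace (Iso1 S T)) =
    MeasurableSpace.comap toFun (@MeasurableSpace.pi Γ (fun _ => Λ) (fun _ => ⊤)) :=
  MeasurableSpace.comap_comp

theorem measurable_toFun :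
    @Measurable _ _ _ (@MeasurableSpace.pi Γ (fun _ => Λ) (fun _ => ⊤))
      (toFun : Iso1 S T → Γ → Λ) := by
  rw [measurable_iff_comap_le, ← measurableSpace_eq_comap]

theorem measurable_apply (x : Γ) :
    @Measurable _ _ _ ⊤ (fun f : Iso1 S T => f.1.toEquiv x) := by
  let : MeasurableSpace Λ := ⊤
  exact (measurable_pi_apply x).comp measurable_toFun

theorem measurableSet_apply_eq (x : Γ) (y : Λ) :
    MeasurableSet {f : Iso1 S T | f.1.toEquiv x = y} :=
  measurable_apply x (MeasurableSpace.measurableSet_top (s := {y}))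

theorem measurable_of_measurableSet_apply_eq [Countable Λ] {X : Type*} [MeasurableSpace X]
    {φ : X → Iso1 S T} (h : ∀ a b, MeasurableSet {x | (φ x).1.toEquiv a = b}) :
    Measurable φ := by
  let : MeasurableSpace Λ := ⊤
  rw [measurable_iff_comap_le, measurableSpace_eq_comap, MeasurableSpace.comap_comp,
    ← measurable_iff_comap_le]
  exact measurable_pi_lambda _ fun a => measurable_to_countable' fun b => h a b

theorem measurable_invEquiv1 [Countable Γ] :
    Measurable (invEquiv1 : Iso1 S T ≃ Iso1 T S) :=
  measurable_of_measurableSet_apply_eq fun a b => by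
    have : {f : Iso1 S T | (invEquiv1 f).1.toEquiv a = b} = {f | f.1.toEquiv b = a} :=
      Set.ext fun f => (Equiv.symm_apply_eq _).trans eq_comm
    exact this ▸ measurableSet_apply_eq b a

theorem isCocycle (μ : Measure (Iso1 S T)) :
    IsCocycle natAct μ fun (γ : Γ) (f : Iso1 S T) => (f.1.toEquiv γ⁻¹)⁻¹ :=
  ⟨fun g h => by simpa [inv_eq_iff_eq_inv] using measurableSet_apply_eq (S := S) (T := T) g⁻¹ h⁻¹,
    fun g h => .of_forall fun f => by simp⟩

theorem lengthPreservingCocycle (μ : Measure (Iso1 S T)) :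
    LengthPreservingCocycle S T μ fun (γ : Γ) (f : Iso1 S T) => (f.1.toEquiv γ⁻¹)⁻¹ :=
  fun g => .of_forall fun f => wlen_inv_apply_inv f g

theorem finite_range_restrict_toFun (hT : IsFinGenSystem T) (I : Finset Γ) :
    (Set.range fun f : Iso1 S T => I.restrict f.toFun).Finite := by
  refine (Set.Finite.pi' fun i : I => hT.finite_setOf_wlen_eq (wlen S i.1)).subset ?_
  rintro _ ⟨f, rfl⟩ i
  exact wlen_apply f i.1

/-- An invariant probability measure gives each cylinder on a finite set the same mass. -/
theorem measure_restrict_toFun_preimage_singleton (hT : IsFinGenSystem T)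
    (μ : Measure (Iso1 S T)) [IsProbabilityMeasure μ]
    (hμ : ∀ k : Iso1 T T, MeasurePreserving (post1 k) μ μ) (I : Finset Γ) (g : Iso1 S T) :
    μ ((fun f : Iso1 S T => I.restrict f.toFun) ⁻¹' {I.restrict g.toFun}) =
      ((finite_range_restrict_toFun (S := S) hT I).toFinset.card : ENNReal)⁻¹ := by
  set r : Iso1 S T → I → Λ := fun f => I.restrict f.toFun with hr
  have hmeas (y : I → Λ) : MeasurableSet (r ⁻¹' {y}) := by
    have : r ⁻¹' {y} = ⋂ i : I, {f | f.1.toEquiv i.1 = y i} := by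
      ext f; simp [hr, funext_iff, toFun]
    rw [this]
    exact .iInter fun i => measurableSet_apply_eq _ _
  have hconst (g' : Iso1 S T) : μ (r ⁻¹' {r g'}) = μ (r ⁻¹' {r g}) := by
    obtain ⟨k, hk⟩ := exists_post1_eq g g'
    rw [← (hμ k).measure_preimage (hmeas (r g')).nullMeasurableSet]
    congr 1
    ext f
    simp [← hk, hr, funext_iff, toFun]
  set R := (finite_range_restrict_toFun (S := S) hT I).toFinset
  have hsum : ∑ y ∈ R, μ (r ⁻¹' {y}) = 1 := by
    rw [sum_measure_preimage_singleton _ fun y _ => hmeas y]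
    simp [R, hr]
  rw [Finset.sum_congr rfl (g := fun _ => μ (r ⁻¹' {r g})), Finset.sum_const, nsmul_eq_mul,
    mul_comm] at hsum
  · exact ENNReal.eq_inv_of_mul_eq_one_left hsum
  · intro y hy
    obtain ⟨g', rfl⟩ := (Set.Finite.mem_toFinset _).mp hy
    exact hconst g'

/-- Uniqueness of the Haar probability measure on `Iso₁(Γ,Λ)`. -/
theorem measure_eq_of_measurePreserving_post1 (hT : IsFinGenSystem T)
    (μ ν : Measure (Iso1 S T)) [IsProbabilityMeasure μ] [IsProbabilityMeasure ν]
    (hμ : ∀ k : Iso1 T T, MeasurePreserving (post1 k) μ μ)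
    (hν : ∀ k : Iso1 T T, MeasurePreserving (post1 k) ν ν) : μ = ν := by
  let : MeasurableSpace Λ := ⊤
  have : Countable Λ := hT.countable
  have hfun : Measurable (toFun : Iso1 S T → Γ → Λ) := measurable_toFun
  have hmap : μ.map toFun = ν.map toFun := by
    have : ∀ I : Finset Γ, IsFiniteMeasure ((ν.map toFun).map I.restrict) := fun I => inferInstance
    refine IsProjectiveLimit.unique (P := fun I => (ν.map toFun).map I.restrict)
      (fun I => ?_) fun I => rfl
    have hI : Measurable (I.restrict : (Γ → Λ) → I → Λ) := Finset.measurable_restrict I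
    change _ = (ν.map toFun).map I.restrict
    rw [Measure.map_map hI hfun, Measure.map_map hI hfun]
    refine Measure.ext_of_singleton fun y => ?_
    rw [Measure.map_apply (hI.comp hfun) (measurableSet_singleton y),
      Measure.map_apply (hI.comp hfun) (measurableSet_singleton y)]
    by_cases hy : ∃ g : Iso1 S T, I.restrict g.toFun = y
    · obtain ⟨g, rfl⟩ := hy
      exact (measure_restrict_toFun_preimage_singleton hT μ hμ I g).trans
        (measure_restrict_toFun_preimage_singleton hT ν hν I g).symm
    · have : (I.restrict ∘ toFun : Iso1 S T → I → Λ) ⁻¹' {y} = ∅ :=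
        Set.eq_empty_of_forall_notMem fun g hg => hy ⟨g, hg⟩
      rw [this, measure_empty, measure_empty]
  ext A hA
  obtain ⟨B, hB, rfl⟩ := measurableSpace_eq_comap.le A hA
  rw [← Measure.map_apply hfun hB, hmap, Measure.map_apply hfun hB]

theorem measurePreserving_invEquiv1 [Countable Γ] (hS : IsFinGenSystem S)
    (μ : Measure (Iso1 S T)) (ν : Measure (Iso1 T S))
    [IsProbabilityMeasure μ] [IsProbabilityMeasure ν]
    (hμ : ∀ h : Iso1 S S, MeasurePreserving (pre1 h) μ μ)
    (hν : ∀ k : Iso1 S S, MeasurePreserving (post1 k) ν ν) :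
    MeasurePreserving (invEquiv1 : Iso1 S T ≃ Iso1 T S) μ ν := by
  have hinv : Measurable (invEquiv1 : Iso1 S T ≃ Iso1 T S) := measurable_invEquiv1
  have := Measure.isProbabilityMeasure_map (μ := μ) hinv.aemeasurable
  refine ⟨hinv, measure_eq_of_measurePreserving_post1 hS _ ν (fun k => ?_) hν⟩
  have hk : Measurable (post1 k : Iso1 T S → Iso1 T S) := (hν k).measurable
  refine ⟨hk, ?_⟩
  rw [Measure.map_map hk hinv]
  have hcomp : (post1 k ∘ invEquiv1 : Iso1 S T → Iso1 T S) = invEquiv1 ∘ pre1 (invEquiv1 k) :=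
    funext fun f => (invEquiv1_pre1_inv k f).symm
  rw [hcomp, ← Measure.map_map hinv (hμ _).measurable, (hμ _).map_eq]

end Iso1

end IOE

open MeasureTheory IOE IOE.Iso1

/-- For finitely generated groups with isometric Cayley graphs, the maps
`σ(γ,f) := f(γ⁻¹)⁻¹` and `τ(λ,f) := f(λ⁻¹)⁻¹` are length-preserving cocycles for the
natural actions on `Iso₁(Γ,Λ)` and `Iso₁(Λ,Γ)` (with their Haar probability measures),
and the inverse map is a measure-preserving bimeasurable bijection intertwining the two
actions via these cocycles. -/
theorem stmt3
    {Γ Λ : Type*} [Group Γ] [Group Λ]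
    (SΓ : Set Γ) (SΛ : Set Λ) (hSΓ : IsFinGenSystem SΓ) (hSΛ : IsFinGenSystem SΛ)
    (hiso : Nonempty (CayleyIso SΓ SΛ))
    (μ : Measure (Iso1 SΓ SΛ)) (ν : Measure (Iso1 SΛ SΓ))
    [IsProbabilityMeasure μ] [IsProbabilityMeasure ν]
    -- `μ` is the Haar probability measure on `Iso₁(Γ,Λ)`: it is invariant under
    -- pre-composition by `Iso₁(Γ)` and post-composition by `Iso₁(Λ)`
    (hμpre : ∀ h : Iso1 SΓ SΓ, MeasurePreserving (pre1 h) μ μ)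
    (hμpost : ∀ k : Iso1 SΛ SΛ, MeasurePreserving (post1 k) μ μ)
    (hνpre : ∀ h : Iso1 SΛ SΛ, MeasurePreserving (pre1 h) ν ν)
    (hνpost : ∀ k : Iso1 SΓ SΓ, MeasurePreserving (post1 k) ν ν) :
    -- (i) `σ` is a length-preserving cocycle
    (IsCocycle (natAct : Γ → Iso1 SΓ SΛ → Iso1 SΓ SΛ) μ
        (fun (γ : Γ) (f : Iso1 SΓ SΛ) => (f.1.toEquiv γ⁻¹)⁻¹) ∧
      LengthPreservingCocycle SΓ SΛ μ
        (fun (γ : Γ) (f : Iso1 SΓ SΛ) => (f.1.toEquiv γ⁻¹)⁻¹)) ∧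
    -- (ii) `τ` is a length-preserving cocycle
    (IsCocycle (natAct : Λ → Iso1 SΛ SΓ → Iso1 SΛ SΓ) ν
        (fun (lam : Λ) (f : Iso1 SΛ SΓ) => (f.1.toEquiv lam⁻¹)⁻¹) ∧
      LengthPreservingCocycle SΛ SΓ ν
        (fun (lam : Λ) (f : Iso1 SΛ SΓ) => (f.1.toEquiv lam⁻¹)⁻¹)) ∧
    -- (iii) the inverse map is a p.m.p. isomorphism intertwining the actions
    (Measurable (invEquiv1 : Iso1 SΓ SΛ ≃ Iso1 SΛ SΓ) ∧
      Measurable (invEquiv1 : Iso1 SΓ SΛ ≃ Iso1 SΛ SΓ).symm ∧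
      MeasurePreserving (invEquiv1 : Iso1 SΓ SΛ ≃ Iso1 SΛ SΓ) μ ν ∧
      (∀ (γ : Γ) (f : Iso1 SΓ SΛ),
        invEquiv1 (natAct γ f) = natAct ((f.1.toEquiv γ⁻¹)⁻¹) (invEquiv1 f)) ∧
      (∀ (lam : Λ) (f : Iso1 SΛ SΓ),
        invEquiv1 (natAct ((f.1.toEquiv lam⁻¹)⁻¹)
            ((invEquiv1 : Iso1 SΓ SΛ ≃ Iso1 SΛ SΓ).symm f)) = natAct lam f)) := by
  have hΓ : Countable Γ := hSΓ.countable
  have hΛ : Countable Λ := hSΛ.countable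
  refine ⟨⟨isCocycle μ, lengthPreservingCocycle μ⟩, ⟨isCocycle ν, lengthPreservingCocycle ν⟩,
    measurable_invEquiv1, measurable_invEquiv1,
    measurePreserving_invEquiv1 hSΓ μ ν hμpre hνpost, invEquiv1_natAct, fun lam f => ?_⟩
  rw [invEquiv1_natAct, Equiv.apply_symm_apply, inv_inv, invEquiv1_symm_apply,
    Equiv.symm_apply_apply, inv_inv]
end
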